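/- Let f : ℝⁿ → ℝ be λ-strongly convex (λ > 0) and differentiable with L-Lipschitz gradient (L > 0), with minimizer x* ∈ ℝⁿ. Let D be a finite set of unit vectors in ℝⁿ and μ > 0 be such that for every nonzero v ∈ ℝⁿ there exists d ∈ D with ⟨v, d⟩ ≥ μ‖v‖. Let c > 0, α > 0, x ∈ ℝⁿ. If f(x + αd) > f(x) − cα² for all d ∈ D, then ‖x − x*‖ ≤ (L/2 + c)α/(μλ). -/

import Mathlib

open scoped RealInnerProductSpace

section HilbertSpace

variable {E : Type*} [NormedAddCommGroup E] [InnerProductSpace ℝ E] [CompleteSpace E]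
  {f : E → ℝ}

/-- The descent lemma: a function with `L`-Lipschitz gradient lies below its quadratic model. -/
theorem le_add_inner_gradient_add_sq {L : ℝ} (hdiff : Differentiable ℝ f)
    (hlip : ∀ x y : E, ‖gradient f x - gradient f y‖ ≤ L * ‖x - y‖) (x h : E) :
    f (x + h) ≤ f x + ⟪gradient f x, h⟫ + L / 2 * ‖h‖ ^ 2 := by
  have hderiv (t : ℝ) : HasDerivAt
      (fun t : ℝ => f (x + t • h) - t * ⟪gradient f x, h⟫ - L / 2 * ‖h‖ ^ 2 * t ^ 2)
      (⟪gradient f (x + t • h), h⟫ - ⟪gradient f x, h⟫ - L * ‖h‖ ^ 2 * t) t := by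
    have hline : HasDerivAt (fun t : ℝ => x + t • h) h t := by
      simpa using ((hasDerivAt_id t).smul_const h).const_add x
    have hf := (hdiff (x + t • h)).hasGradientAt.hasFDerivAt.comp_hasDerivAt t hline
    rw [InnerProductSpace.toDual_apply_apply] at hf
    have hlin := (hasDerivAt_id t).mul_const ⟪gradient f x, h⟫
    have hquad := (hasDerivAt_pow 2 t).const_mul (L / 2 * ‖h‖ ^ 2)
    refine ((hf.sub hlin).sub hquad).congr_deriv ?_
    norm_num
    ring
  have hanti : AntitoneOn
      (fun t : ℝ => f (x + t • h) - t * ⟪gradient f x, h⟫ - L / 2 * ‖h‖ ^ 2 * t ^ 2)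
      (Set.Ici 0) := by
    refine antitoneOn_of_hasDerivWithinAt_nonpos (convex_Ici 0)
      (fun t _ => (hderiv t).continuousAt.continuousWithinAt)
      (fun t _ => (hderiv t).hasDerivWithinAt) fun t ht => ?_
    have ht : 0 < t := by simpa using ht
    have hgrad := hlip (x + t • h) x
    rw [add_sub_cancel_left, norm_smul, Real.norm_of_nonneg ht.le] at hgrad
    rw [← inner_sub_left]
    have hcs := real_inner_le_norm (gradient f (x + t • h) - gradient f x) h
    nlinarith [mul_le_mul_of_nonneg_right hgrad (norm_nonneg h)]
  have := hanti (Set.mem_Ici.2 le_rfl) (Set.mem_Ici.2 zero_le_one) zero_le_one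
  simp only [one_smul, zero_smul, add_zero] at this
  linarith

/-- The distance to the minimizer of a strongly convex function is controlled by the gradient. -/
theorem mul_norm_sub_le_norm_gradient {m : ℝ}
    (hsc : ∀ x y : E, f x + ⟪gradient f x, y - x⟫ + m / 2 * ‖y - x‖ ^ 2 ≤ f y)
    {xstar : E} (hmin : ∀ y, f xstar ≤ f y) (x : E) :
    m * ‖x - xstar‖ ≤ ‖gradient f x‖ := by
  have hzero : gradient f xstar = 0 := by
    have hloc : IsLocalMin f xstar := Filter.Eventually.of_forall hmin
    simp [gradient, hloc.fderiv_eq_zero]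
  have hstar := hsc xstar x
  have hx := hsc x xstar
  rw [hzero, inner_zero_left] at hstar
  rw [← neg_sub x xstar, inner_neg_right, norm_neg] at hx
  have hcs := real_inner_le_norm (gradient f x) (x - xstar)
  rcases (norm_nonneg (x - xstar)).eq_or_lt with h0 | hpos
  · simp [← h0]
  · refine le_of_mul_le_mul_right ?_ hpos
    nlinarith

end HilbertSpace

theorem sds_strongly_convex_distance_bound {n : ℕ}
    (f : EuclideanSpace ℝ (Fin n) → ℝ)
    (L : ℝ) (hL : 0 < L) (hdiff : Differentiable ℝ f)
    (hlip : ∀ x y : EuclideanSpace ℝ (Fin n), ‖gradient f x - gradient f y‖ ≤ L * ‖x - y‖)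
    (lam : ℝ) (hlam : 0 < lam)
    (hsc : ∀ x y : EuclideanSpace ℝ (Fin n),
      f x + ⟪gradient f x, y - x⟫ + lam / 2 * ‖y - x‖ ^ 2 ≤ f y)
    (xstar : EuclideanSpace ℝ (Fin n)) (hmin : ∀ y, f xstar ≤ f y)
    (D : Finset (EuclideanSpace ℝ (Fin n))) (hDunit : ∀ d ∈ D, ‖d‖ = 1)
    (μ : ℝ) (hμ : 0 < μ)
    (hcos : ∀ v : EuclideanSpace ℝ (Fin n), v ≠ 0 → ∃ d ∈ D, μ * ‖v‖ ≤ ⟪v, d⟫)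
    (c α : ℝ) (hc : 0 < c) (hα : 0 < α)
    (x : EuclideanSpace ℝ (Fin n))
    (hfail : ∀ d ∈ D, f (x + α • d) > f x - c * α ^ 2) :
    ‖x - xstar‖ ≤ (L / 2 + c) * α / (μ * lam) := by
  have hgrad : μ * ‖gradient f x‖ ≤ (L / 2 + c) * α := by
    by_cases hzero : gradient f x = 0
    · rw [hzero, norm_zero, mul_zero]
      positivity
    · obtain ⟨d, hd, hangle⟩ := hcos (-gradient f x) (neg_ne_zero.2 hzero)
      rw [norm_neg, inner_neg_left] at hangle
      have hdescent := le_add_inner_gradient_add_sq hdiff hlip x (α • d)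
      rw [real_inner_smul_right, norm_smul, hDunit d hd, mul_one,
        Real.norm_of_nonneg hα.le] at hdescent
      have := hfail d hd
      refine le_of_mul_le_mul_left ?_ hα
      nlinarith [mul_le_mul_of_nonneg_left hangle hα.le]
  rw [le_div_iff₀ (mul_pos hμ hlam)]
  nlinarith [mul_le_mul_of_nonneg_left (mul_norm_sub_le_norm_gradient hsc hmin x) hμ.le]
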